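/- arXiv:1809.09669 — 3 statements merged into one kernel-verified Lean document; each statement's English description precedes it below -/
import Mathlib

section
/- Let E be a complex Banach space, T > 0, n a positive integer, 0 < γ < 1, and let f : ℝ → E be T-periodic and n times continuously differentiable, with n-th derivative f^{(n)} being γ-Hölder continuous with Hölder seminorm [f^{(n)}]_γ := sup_{α₁ ≠ α₂} ‖f^{(n)}(α₁) − f^{(n)}(α₂)‖_E / |α₁ − α₂|^γ < ∞. Then for every nonzero integer j, the Fourier coefficient f̂_j := (1/T)∫₀ᵀ f(α) e^{−2πi jα/T} dα satisfies ‖f̂_j‖_E ≤ (T/(2π|j|))^n · (1/2) (T/(2|j|))^γ · [f^{(n)}]_γ. In particular ‖f̂_j‖_E ≤ C |T/(2π j)|^{n+γ} for a constant C depending only on f, n, γ, T. -/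
open MeasureTheory

theorem Function.Periodic.deriv_periodic {E : Type*} [NormedAddCommGroup E] [NormedSpace ℝ E]
    {f : ℝ → E} {T : ℝ} (hf : Function.Periodic f T) : Function.Periodic (deriv f) T := by
  intro x
  rw [← deriv_comp_add_const, funext hf]

theorem Function.Periodic.iteratedDeriv_periodic {E : Type*} [NormedAddCommGroup E]
    [NormedSpace ℝ E] {f : ℝ → E} {T : ℝ} (hf : Function.Periodic f T) (n : ℕ) :
    Function.Periodic (iteratedDeriv n f) T := by
  induction n with
  | zero => simpa using hf
  | succ n ih => simpa only [iteratedDeriv_succ] using ih.deriv_periodic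

section

variable {E : Type*} [NormedAddCommGroup E] [NormedSpace ℂ E]

theorem Function.Periodic.cexp_mul_smul {c : ℂ} {T : ℝ} (hc : Complex.exp (c * T) = 1)
    {g : ℝ → E} (hg : Function.Periodic g T) :
    Function.Periodic (fun α : ℝ => Complex.exp (c * α) • g α) T := by
  intro α
  simp only [Complex.ofReal_add, mul_add, Complex.exp_add, hc, mul_one, hg α]

theorem integral_cexp_smul_deriv_of_periodic [CompleteSpace E] {c : ℂ} {T : ℝ}
    (hc : Complex.exp (c * T) = 1) {g : ℝ → E} (hper : Function.Periodic g T)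
    (hg : ContDiff ℝ 1 g) :
    ∫ α in (0:ℝ)..T, Complex.exp (c * α) • deriv g α
      = (-c) • ∫ α in (0:ℝ)..T, Complex.exp (c * α) • g α := by
  have hg' : Continuous (deriv g) := hg.continuous_deriv le_rfl
  have hgc : Continuous g := hg.continuous
  have hderiv : ∀ α : ℝ, HasDerivAt (fun α : ℝ => Complex.exp (c * α) • g α)
      (Complex.exp (c * α) • deriv g α + c • Complex.exp (c * α) • g α) α := by
    intro α
    have he : HasDerivAt (fun α : ℝ => Complex.exp (c * α)) (Complex.exp (c * α) * c) α := by
      have := ((Complex.ofRealCLM.hasDerivAt (x := α)).const_mul c).cexp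
      simpa using this
    have := he.smul ((hg.differentiable one_ne_zero) α).hasDerivAt
    rw [mul_comm (Complex.exp _) c, mul_smul] at this
    exact this
  have hi : ∀ u : ℝ → E, Continuous u →
      IntervalIntegrable (fun α : ℝ => Complex.exp (c * α) • u α) volume 0 T := fun u hu =>
    Continuous.intervalIntegrable (by fun_prop) _ _
  have hic : IntervalIntegrable (fun α : ℝ => c • Complex.exp (c * α) • g α) volume 0 T :=
    (hi _ hgc).smul c
  have hFTC := intervalIntegral.integral_eq_sub_of_hasDerivAt (fun α _ => hderiv α)
    ((hi _ hg').add hic)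
  have h0 : g T = g 0 := by simpa using hper 0
  rw [intervalIntegral.integral_add (hi _ hg') hic,
    intervalIntegral.integral_smul, hc, h0] at hFTC
  rw [neg_smul]
  exact eq_neg_of_add_eq_zero_left (by simpa using hFTC)

theorem integral_cexp_smul_iteratedDeriv_of_periodic [CompleteSpace E] {c : ℂ} {T : ℝ}
    (hc : Complex.exp (c * T) = 1) (n : ℕ) {f : ℝ → E} (hper : Function.Periodic f T)
    (hf : ContDiff ℝ n f) :
    ∫ α in (0:ℝ)..T, Complex.exp (c * α) • iteratedDeriv n f α
      = (-c) ^ n • ∫ α in (0:ℝ)..T, Complex.exp (c * α) • f α := by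
  induction n with
  | zero => simp
  | succ n ih =>
    have h1 : ContDiff ℝ 1 (iteratedDeriv n f) := by
      rw [iteratedDeriv_eq_iterate]
      exact ContDiff.iterate_deriv' 1 n (by rwa [add_comm 1 n])
    rw [iteratedDeriv_succ,
      integral_cexp_smul_deriv_of_periodic hc (hper.iteratedDeriv_periodic n) h1,
      ih (hf.of_le (by exact_mod_cast n.le_succ)), smul_smul, pow_succ']

theorem two_smul_integral_cexp_smul_of_periodic {c : ℂ} {T h : ℝ}
    (hc : Complex.exp (c * T) = 1) (hh : Complex.exp (c * h) = -1) {g : ℝ → E}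
    (hper : Function.Periodic g T) (hg : Continuous g) :
    (2 : ℂ) • ∫ α in (0:ℝ)..T, Complex.exp (c * α) • g α
      = ∫ α in (0:ℝ)..T, Complex.exp (c * α) • (g α - g (α + h)) := by
  have hshift : ∫ α in (0:ℝ)..T, Complex.exp (c * α) • g (α + h)
      = -∫ α in (0:ℝ)..T, Complex.exp (c * α) • g α := by
    have h1 := intervalIntegral.integral_comp_add_right
      (fun α : ℝ => Complex.exp (c * α) • g α) h (a := 0) (b := T)
    have h2 := (hper.cexp_mul_smul hc).intervalIntegral_add_eq h 0
    rw [zero_add, add_comm T h, h2, zero_add] at h1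
    rw [← h1, ← intervalIntegral.integral_neg]
    refine intervalIntegral.integral_congr fun α _ => ?_
    simp [mul_add, Complex.exp_add, hh]
  simp only [smul_sub]
  rw [intervalIntegral.integral_sub (Continuous.intervalIntegrable (by fun_prop) _ _)
    (Continuous.intervalIntegrable (by fun_prop) _ _), hshift, two_smul, sub_neg_eq_add]

end

/-- Decay of Fourier coefficients of a `T`-periodic function that is `n` times continuously
differentiable with `γ`-Hölder `n`-th derivative:
`‖f̂_j‖ ≤ (T/(2π|j|))^n ⋅ (1/2)(T/(2|j|))^γ ⋅ [f^{(n)}]_γ` for `j ≠ 0`. -/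
theorem stmt_3 {E : Type*} [NormedAddCommGroup E] [NormedSpace ℂ E] [CompleteSpace E]
    (T : ℝ) (hT : 0 < T) (n : ℕ) (hn : 0 < n) (γ : ℝ) (hγ0 : 0 < γ) (hγ1 : γ < 1)
    (f : ℝ → E) (hper : Function.Periodic f T) (hf : ContDiff ℝ n f)
    (C : ℝ)
    (hC : ∀ α₁ α₂ : ℝ, ‖iteratedDeriv n f α₁ - iteratedDeriv n f α₂‖ ≤ C * |α₁ - α₂| ^ γ)
    (j : ℤ) (hj : j ≠ 0) :
    ‖(1 / (T : ℂ)) • ∫ α in (0:ℝ)..T,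
        Complex.exp (-(((2 * Real.pi * (j : ℝ) * α / T : ℝ) : ℂ) * Complex.I)) • f α‖
      ≤ (T / (2 * Real.pi * |(j : ℝ)|)) ^ n * ((1 / 2) * (T / (2 * |(j : ℝ)|)) ^ γ) * C := by
  have hTc : (T : ℂ) ≠ 0 := by exact_mod_cast hT.ne'
  have hjc : (j : ℂ) ≠ 0 := by exact_mod_cast hj
  have hjr : 0 < |(j : ℝ)| := abs_pos.mpr (by exact_mod_cast hj)
  set c : ℂ := ((-(2 * Real.pi * j / T) : ℝ) : ℂ) * Complex.I with hcdef
  have hexp : ∀ α : ℝ, -(((2 * Real.pi * (j : ℝ) * α / T : ℝ) : ℂ) * Complex.I) = c * α := by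
    intro α
    rw [hcdef]
    push_cast
    ring
  have hcT : Complex.exp (c * T) = 1 := by
    rw [Complex.exp_eq_one_iff]
    refine ⟨-j, ?_⟩
    rw [hcdef]
    push_cast
    field_simp
  have hch : Complex.exp (c * (T / (2 * j) : ℝ)) = -1 := by
    have : c * (T / (2 * j) : ℝ) = -(Real.pi * Complex.I) := by
      rw [hcdef]
      push_cast
      field_simp
    rw [this, Complex.exp_neg, Complex.exp_pi_mul_I]
    norm_num
  have hnc : ‖c‖ = 2 * Real.pi * |(j : ℝ)| / T := by
    rw [hcdef, norm_mul, Complex.norm_I, mul_one, Complex.norm_real, Real.norm_eq_abs, abs_neg,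
      abs_div, abs_mul, abs_of_pos hT, abs_of_pos Real.two_pi_pos]
  have hne : ∀ α : ℝ, ‖Complex.exp (c * α)‖ = 1 := by
    intro α
    have : c * α = ((-(2 * Real.pi * j / T) * α : ℝ) : ℂ) * Complex.I := by
      rw [hcdef]
      push_cast
      ring
    rw [this, Complex.norm_exp_ofReal_mul_I]
  have hpos : 0 < 2 * Real.pi * |(j : ℝ)| / T := by positivity
  simp only [hexp]
  have hparts := integral_cexp_smul_iteratedDeriv_of_periodic hcT n hper hf
  have haverage := two_smul_integral_cexp_smul_of_periodic hcT hch
    (hper.iteratedDeriv_periodic n) (hf.continuous_iteratedDeriv n le_rfl)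
  have hbound : ‖∫ α in (0:ℝ)..T, Complex.exp (c * α) •
      (iteratedDeriv n f α - iteratedDeriv n f (α + T / (2 * j)))‖
        ≤ C * (T / (2 * |(j : ℝ)|)) ^ γ * |T - 0| := by
    refine intervalIntegral.norm_integral_le_of_norm_le_const fun α _ => ?_
    rw [norm_smul, hne, one_mul]
    refine (hC _ _).trans_eq ?_
    rw [sub_add_cancel_left, abs_neg, abs_div, abs_mul, abs_of_pos hT, abs_two]
  rw [← haverage, hparts, norm_smul, norm_smul, norm_pow, norm_neg, hnc, sub_zero,
    abs_of_pos hT, Complex.norm_two] at hbound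
  rw [norm_smul, norm_div, norm_one, Complex.norm_real, Real.norm_of_nonneg hT.le]
  set N := ‖∫ α in (0:ℝ)..T, Complex.exp (c * α) • f α‖
  have hinv : T / (2 * Real.pi * |(j : ℝ)|) = (2 * Real.pi * |(j : ℝ)| / T)⁻¹ := by
    rw [inv_div]
  rw [hinv, inv_pow]
  have hpn := pow_pos hpos n
  generalize (2 * Real.pi * |(j : ℝ)| / T) ^ n = p at hbound hpn ⊢
  generalize (T / (2 * |(j : ℝ)|)) ^ γ = q at hbound ⊢
  calc 1 / T * N = (2 * (p * N)) / (2 * p * T) := by field_simp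
    _ ≤ (C * q * T) / (2 * p * T) := by gcongr
    _ = p⁻¹ * (1 / 2 * q) * C := by field_simp
end

section
/- Let E be a separable complex Hilbert space, T > 0, n a nonnegative integer, 0 < γ < 1, and let f : ℝ → E be T-periodic and n times continuously differentiable with f^{(n)} γ-Hölder continuous. For an even positive integer N define the truncated Fourier sum f_N(α) := Σ_{j = −N/2+1}^{N/2} f̂_j e^{2πi jα/T}, where f̂_j := (1/T)∫₀ᵀ f(α) e^{−2πi jα/T} dα. Then there is a constant C > 0, independent of N, such that (∫₀ᵀ ‖f(α) − f_N(α)‖_E² dα)^{1/2} ≤ C · N^{−n−γ+1/2} · ([f^{(n)}]_γ + Σ_{m=0}^n sup_α ‖f^{(m)}(α)‖_E), where [f^{(n)}]_γ is the γ-Hölder seminorm of f^{(n)}. -/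
open MeasureTheory

section FourierTruncation

open AddCircle

section Parseval

theorem Orthonormal.countable_of_separableSpace {ι 𝕜 E : Type*} [RCLike 𝕜] [NormedAddCommGroup E]
    [InnerProductSpace 𝕜 E] [TopologicalSpace.SeparableSpace E] {v : ι → E}
    (hv : Orthonormal 𝕜 v) : Countable ι := by
  rw [← Set.countable_univ_iff]
  refine Set.PairwiseDisjoint.countable_of_isOpen (s := fun i => Metric.ball (v i) (1 / 2))
    (fun i _ j _ hij => Metric.ball_disjoint_ball ?_) (fun _ _ => Metric.isOpen_ball)
    (fun i _ => ⟨v i, Metric.mem_ball_self (by norm_num)⟩)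
  have h : ‖v i - v j‖ * ‖v i - v j‖ = 1 * 1 + 1 * 1 := by
    have := @norm_sub_sq 𝕜 _ _ _ _ (v i) (v j)
    rw [hv.2 hij, hv.1 i, hv.1 j] at this
    simp at this
    nlinarith
  rw [dist_eq_norm]
  nlinarith [norm_nonneg (v i - v j)]

theorem HilbertBasis.hasSum_norm_sq_inner {ι 𝕜 E : Type*} [RCLike 𝕜] [NormedAddCommGroup E]
    [InnerProductSpace 𝕜 E] (b : HilbertBasis ι 𝕜 E) (x : E) :
    HasSum (fun i => ‖inner 𝕜 (b i) x‖ ^ 2) (‖x‖ ^ 2) := by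
  have H : HasSum (fun i => ‖b.repr x i‖ ^ 2) (‖b.repr x‖ ^ 2) := by
    apply_mod_cast lp.hasSum_norm ?_ (b.repr x)
    simp
  simpa [b.repr_apply_apply] using H

variable {T : ℝ} [hT : Fact (0 < T)]

theorem fourierCoeff_inner {E : Type*} [NormedAddCommGroup E] [InnerProductSpace ℂ E]
    [CompleteSpace E] {F : AddCircle T → E} (hF : Continuous F) (v : E) (j : ℤ) :
    fourierCoeff (fun x => inner ℂ v (F x)) j = inner ℂ v (fourierCoeff F j) := by
  have hint : Integrable (fun t => fourier (-j) t • F t) haarAddCircle :=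
    ((map_continuous _).smul hF).integrable_of_hasCompactSupport
      (HasCompactSupport.of_compactSpace _)
  simp only [fourierCoeff]
  rw [← integral_inner hint]
  simp [inner_smul_right]

theorem hasSum_sq_fourierCoeff_of_continuous {F : AddCircle T → ℂ} (hF : Continuous F) :
    HasSum (fun j => ‖fourierCoeff F j‖ ^ 2) (∫ t, ‖F t‖ ^ 2 ∂haarAddCircle) := by
  have h := hasSum_sq_fourierCoeff (ContinuousMap.toLp (E := ℂ) 2 haarAddCircle ℂ ⟨F, hF⟩)
  simp only [fourierCoeff_toLp] at h
  convert! h using 1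
  apply integral_congr_ae
  filter_upwards [ContinuousMap.coeFn_toLp (E := ℂ) (p := 2) (𝕜 := ℂ) (haarAddCircle (T := T))
    ⟨F, hF⟩] with x hx
  rw [hx, ContinuousMap.coe_mk]

theorem hasSum_norm_sq_fourierCoeff_of_continuous {E : Type*} [NormedAddCommGroup E]
    [InnerProductSpace ℂ E] [CompleteSpace E] [TopologicalSpace.SeparableSpace E]
    {F : AddCircle T → E} (hF : Continuous F) :
    HasSum (fun j => ‖fourierCoeff F j‖ ^ 2) (∫ t, ‖F t‖ ^ 2 ∂haarAddCircle) := by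
  obtain ⟨w, b, -⟩ := exists_hilbertBasis ℂ E
  have := b.orthonormal.countable_of_separableSpace
  have hint {g : AddCircle T → ℝ} (hg : Continuous g) : Integrable g haarAddCircle :=
    hg.integrable_of_hasCompactSupport (HasCompactSupport.of_compactSpace _)
  have hsum (x : E) : ENNReal.ofReal (‖x‖ ^ 2)
      = ∑' i, ENNReal.ofReal (‖inner ℂ (b i) x‖ ^ 2) := by
    rw [← (b.hasSum_norm_sq_inner x).tsum_eq, ENNReal.ofReal_tsum_of_nonneg
      (fun _ => by positivity) (b.hasSum_norm_sq_inner x).summable]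
  have hc (i : w) : Continuous fun x => inner ℂ (b i) (F x) := by fun_prop
  have key : ENNReal.ofReal (∫ t, ‖F t‖ ^ 2 ∂haarAddCircle)
      = ∑' j, ENNReal.ofReal (‖fourierCoeff F j‖ ^ 2) := by
    rw [ofReal_integral_eq_lintegral_ofReal (hint (by fun_prop))
      (Filter.Eventually.of_forall fun _ => by positivity)]
    simp_rw [hsum]
    rw [ENNReal.tsum_comm, lintegral_tsum fun i =>
      (show Continuous fun x => ‖inner ℂ (b i) (F x)‖ ^ 2 from
        (hc i).norm.pow 2).measurable.ennreal_ofReal.aemeasurable]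
    refine tsum_congr fun i => ?_
    have hi := hasSum_sq_fourierCoeff_of_continuous (hc i)
    rw [← ofReal_integral_eq_lintegral_ofReal (hint (by have := hc i; fun_prop))
      (Filter.Eventually.of_forall fun _ => by positivity), ← hi.tsum_eq,
      ENNReal.ofReal_tsum_of_nonneg (fun _ => by positivity) hi.summable]
    simp_rw [fourierCoeff_inner hF]
  have hne : ∑' j, ENNReal.ofReal (‖fourierCoeff F j‖ ^ 2) ≠ ⊤ := key ▸ ENNReal.ofReal_ne_top
  have hs := ENNReal.hasSum_toReal hne
  rw [← ENNReal.tsum_toReal_eq fun _ => ENNReal.ofReal_ne_top, ← key,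
    ENNReal.toReal_ofReal (integral_nonneg fun _ => by positivity)] at hs
  simpa using hs

theorem fourierCoeff_fourier_smul {E : Type*} [NormedAddCommGroup E] [NormedSpace ℂ E]
    [CompleteSpace E] (v : E) (j k : ℤ) :
    fourierCoeff (fun x : AddCircle T => fourier j x • v) k = if k = j then v else 0 := by
  have h := congrFun (fourierCoeff_fourier (T := T) j) k
  simp only [fourierCoeff, smul_smul] at h ⊢
  rw [integral_smul_const]
  simp only [smul_eq_mul] at h
  rw [h, Pi.single_apply]
  split_ifs <;> simp

theorem fourierCoeff_sub_sum_fourier {E : Type*} [NormedAddCommGroup E] [NormedSpace ℂ E]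
    [CompleteSpace E] {F : AddCircle T → E} (hF : Continuous F) (S : Finset ℤ) (k : ℤ) :
    fourierCoeff (fun x => F x - ∑ j ∈ S, fourier j x • fourierCoeff F j) k
      = if k ∈ S then 0 else fourierCoeff F k := by
  have hint {g : AddCircle T → E} (hg : Continuous g) : Integrable g haarAddCircle :=
    hg.integrable_of_hasCompactSupport (HasCompactSupport.of_compactSpace _)
  have h1 (j : ℤ) : Continuous fun x : AddCircle T => fourier j x • fourierCoeff F j :=
    (map_continuous _).smul continuous_const
  have hG : Continuous fun x : AddCircle T => F x - ∑ j ∈ S, fourier j x • fourierCoeff F j :=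
    hF.sub (continuous_finsetSum _ fun j _ => h1 j)
  have h2 : fourierCoeff (fun x : AddCircle T => F x - ∑ j ∈ S, fourier j x • fourierCoeff F j)
      + fourierCoeff (∑ j ∈ S, fun x : AddCircle T => fourier j x • fourierCoeff F j) = fourierCoeff F := by
    rw [← fourierCoeff.add (hint hG)
      (integrable_finsetSum' _ fun j _ => hint (h1 j))]
    congr 1
    ext x
    simp
  rw [fourierCoeff.sum _ _ fun j _ => hint (h1 j)] at h2
  have h3 := congrFun h2 k
  simp only [Pi.add_apply, Finset.sum_apply, fourierCoeff_fourier_smul, Finset.sum_ite_eq] at h3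
  split_ifs at h3 ⊢
  · simpa using h3
  · simpa using h3

end Parseval

theorem tsum_nat_add_rpow_neg_le {p : ℝ} (hp : 1 < p) {M : ℕ} (hM : 0 < M) :
    ∑' k : ℕ, ((k + M : ℕ) : ℝ) ^ (-p) ≤ (1 + 1 / (p - 1)) * (M : ℝ) ^ (1 - p) := by
  have hM' : (1 : ℝ) ≤ M := by exact_mod_cast hM
  have hs : Summable fun k : ℕ => ((k + M : ℕ) : ℝ) ^ (-p) :=
    (summable_nat_add_iff M).2 (Real.summable_nat_rpow.2 (by linarith))
  rw [hs.tsum_eq_zero_add]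
  have h1 : (M : ℝ) ^ (-p) ≤ (M : ℝ) ^ (1 - p) :=
    Real.rpow_le_rpow_of_exponent_le hM' (by linarith)
  have h2 : ∑' k : ℕ, ((k + 1 + M : ℕ) : ℝ) ^ (-p) ≤ 1 / (p - 1) * (M : ℝ) ^ (1 - p) := by
    refine Real.tsum_le_of_sum_range_le (fun _ => by positivity) fun R => ?_
    have hanti : AntitoneOn (fun x : ℝ => x ^ (-p)) (Set.Icc (M : ℝ) (M + R)) :=
      fun x hx y _ hxy => Real.rpow_le_rpow_of_nonpos (by linarith [hx.1]) hxy (by linarith)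
    have h := hanti.sum_le_integral
    have h0 : (0 : ℝ) ∉ Set.uIcc (M : ℝ) (M + R) := by
      rw [Set.uIcc_of_le (by simp)]
      exact fun h => by linarith [h.1]
    rw [integral_rpow (Or.inr ⟨by linarith, h0⟩)] at h
    have h3 : 0 ≤ ((M : ℝ) + R) ^ (-p + 1) := by positivity
    calc _ = ∑ i ∈ Finset.range R, ((M : ℝ) + (i + 1 : ℕ)) ^ (-p) := by
          refine Finset.sum_congr rfl fun i _ => ?_
          push_cast
          congr 1
          ring
      _ ≤ _ := h
      _ = ((M : ℝ) ^ (1 - p) - ((M : ℝ) + R) ^ (-p + 1)) / (p - 1) := by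
          rw [show -p + 1 = -(p - 1) by ring, show 1 - p = -(p - 1) by ring, div_neg, ← neg_div]
          congr 1
          ring
      _ ≤ _ := by
          rw [one_div_mul_eq_div]
          gcongr
          all_goals linarith
  have h3 : ((0 + M : ℕ) : ℝ) = M := by simp
  rw [h3]
  linarith

theorem summable_and_tsum_int_tail_le {p : ℝ} (hp : 1 < p) {M : ℕ} (hM : 0 < M) :
    Summable (fun j : ℤ => if M ≤ j.natAbs then (j.natAbs : ℝ) ^ (-p) else 0) ∧
    ∑' j : ℤ, (if M ≤ j.natAbs then (j.natAbs : ℝ) ^ (-p) else 0)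
      ≤ 2 * (1 + 1 / (p - 1)) * (M : ℝ) ^ (1 - p) := by
  set w : ℕ → ℝ := fun k => if M ≤ k then (k : ℝ) ^ (-p) else 0 with hw
  have hw0 (k : ℕ) : 0 ≤ w k := by simp only [hw]; split_ifs <;> positivity
  have hws : Summable w := (Real.summable_nat_rpow.2 (by linarith : -p < -1)).of_nonneg_of_le hw0
    fun k => by
      simp only [hw]
      split_ifs
      · rfl
      · positivity
  have hw1 : Summable fun k => w (k + 1) := (summable_nat_add_iff 1).2 hws
  have hle : ∑' k, w k ≤ (1 + 1 / (p - 1)) * (M : ℝ) ^ (1 - p) := by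
    rw [← hws.sum_add_tsum_nat_add M, Finset.sum_eq_zero fun i hi => if_neg (by
      simpa using hi), zero_add]
    simpa [hw] using tsum_nat_add_rpow_neg_le hp hM
  have hle1 : ∑' k, w (k + 1) ≤ ∑' k, w k := by
    rw [hws.tsum_eq_zero_add]
    linarith [hw0 0]
  have hsum : HasSum (fun j : ℤ => w j.natAbs) (∑' k, w k + ∑' k, w (k + 1)) := by
    refine HasSum.of_nat_of_neg_add_one ?_ ?_
    · simpa using hws.hasSum
    · convert! hw1.hasSum using 3
  exact ⟨hsum.summable, by rw [show (∑' j : ℤ, if M ≤ j.natAbs then (j.natAbs : ℝ) ^ (-p) else 0)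
    = _ from hsum.tsum_eq]; linarith⟩

section
variable {E : Type*} [NormedAddCommGroup E] [NormedSpace ℂ E]

theorem Function.Periodic.deriv_of_periodic {f : ℝ → E} {T : ℝ} (hf : Function.Periodic f T) :
    Function.Periodic (deriv f) T := fun x => by
  rw [← deriv_comp_add_const, hf.funext]

theorem Function.Periodic.iteratedDeriv_of_periodic {f : ℝ → E} {T : ℝ} (hf : Function.Periodic f T) (n : ℕ) :
    Function.Periodic (iteratedDeriv n f) T := by
  induction n with
  | zero => simpa using hf
  | succ n ih => rw [iteratedDeriv_succ]; exact ih.deriv_of_periodic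

theorem intervalIntegral_fourier_smul_deriv [CompleteSpace E] {T : ℝ} {f f' : ℝ → E}
    (hper : Function.Periodic f T)
    (hf : ∀ x, HasDerivAt f (f' x) x) (hf' : Continuous f') (j : ℤ) :
    ∫ x in (0 : ℝ)..T, fourier (-j) (x : AddCircle T) • f' x
      = (2 * Real.pi * Complex.I * j / T) •
        ∫ x in (0 : ℝ)..T, fourier (-j) (x : AddCircle T) • f x := by
  have hc : Continuous fun x : ℝ => fourier (-j) (x : AddCircle T) :=
    (map_continuous (fourier (-j))).comp (AddCircle.continuous_mk' T)
  rw [intervalIntegral.integral_smul_deriv_eq_deriv_smul_of_hasDerivAt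
    (u := fun x : ℝ => fourier (-j) (x : AddCircle T)) hc.continuousOn
    (fun x _ => (hf x).continuousAt.continuousWithinAt)
    (fun x _ => hasDerivAt_fourier_neg T j x) (fun x _ => hf x)
    ((hc.const_mul _).intervalIntegrable _ _) (hf'.intervalIntegrable _ _)]
  have h0 : f T = f 0 := by simpa using hper 0
  have h1 : ((T : ℝ) : AddCircle T) = ((0 : ℝ) : AddCircle T) := by simp
  rw [h0, h1, sub_self, zero_sub, ← intervalIntegral.integral_smul, ← intervalIntegral.integral_neg]
  refine intervalIntegral.integral_congr fun x _ => ?_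
  simp only [smul_smul, ← neg_smul]
  congr 1
  ring

theorem intervalIntegral_fourier_smul_iteratedDeriv [CompleteSpace E] {T : ℝ} {f : ℝ → E}
    (hper : Function.Periodic f T) (n : ℕ) (hf : ContDiff ℝ n f) (j : ℤ) :
    ∫ x in (0 : ℝ)..T, fourier (-j) (x : AddCircle T) • iteratedDeriv n f x
      = (2 * Real.pi * Complex.I * j / T) ^ n •
        ∫ x in (0 : ℝ)..T, fourier (-j) (x : AddCircle T) • f x := by
  induction n with
  | zero => simp
  | succ n ih =>
    have hd (x : ℝ) : HasDerivAt (iteratedDeriv n f) (iteratedDeriv (n + 1) f x) x := by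
      rw [iteratedDeriv_succ]
      exact (hf.differentiable_iteratedDeriv n (by exact_mod_cast n.lt_succ_self) x).hasDerivAt
    rw [intervalIntegral_fourier_smul_deriv (hper.iteratedDeriv_of_periodic n) hd
      (hf.continuous_iteratedDeriv (n + 1) le_rfl), ih (hf.of_le (by norm_cast; omega)), smul_smul,
      pow_succ']

theorem norm_intervalIntegral_fourier_smul_le {T : ℝ} [hT : Fact (0 < T)] {g : ℝ → E}
    (hper : Function.Periodic g T)
    (hg : Continuous g) {C γ : ℝ} (hC : ∀ x y, ‖g x - g y‖ ≤ C * |x - y| ^ γ) {j : ℤ} (hj : j ≠ 0) :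
    ‖∫ x in (0 : ℝ)..T, fourier (-j) (x : AddCircle T) • g x‖
      ≤ T / 2 * (C * (T / 2 / |(j : ℝ)|) ^ γ) := by
  have hT0 := hT.out
  set h : ℝ := T / 2 / (-j : ℤ) with hh
  have hcf : Continuous fun x : ℝ => fourier (-j) (x : AddCircle T) :=
    (map_continuous (fourier (-j))).comp (AddCircle.continuous_mk' T)
  set φ : ℝ → E := fun x => fourier (-j) (x : AddCircle T) • g x with hφ
  have hφp : Function.Periodic φ T := fun x => by
    simp only [hφ, hper x, AddCircle.coe_add_period]
  have hφc : Continuous φ := hcf.smul hg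
  have hshift : ∫ x in (0 : ℝ)..T, φ x = ∫ x in (0 : ℝ)..T, φ (x + h) := by
    rw [intervalIntegral.integral_comp_add_right]
    simpa [add_comm] using hφp.intervalIntegral_add_eq 0 h
  have hneg (x : ℝ) : φ (x + h) = -(fourier (-j) (x : AddCircle T) • g (x + h)) := by
    simp only [hφ, ← neg_smul]
    congr 1
    rw [AddCircle.coe_add]
    exact fourier_add_half_inv_index (neg_ne_zero.2 hj) hT0 _
  have h2 : (2 : ℝ) • ∫ x in (0 : ℝ)..T, φ x
      = ∫ x in (0 : ℝ)..T, fourier (-j) (x : AddCircle T) • (g x - g (x + h)) := by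
    rw [two_smul]
    nth_rewrite 2 [hshift]
    rw [← intervalIntegral.integral_add (hφc.intervalIntegrable _ _)
      ((by fun_prop : Continuous fun x => φ (x + h)).intervalIntegrable _ _)]
    refine intervalIntegral.integral_congr fun x _ => ?_
    simp only [hneg]
    rw [smul_sub, sub_eq_add_neg]
  have habs : |h| = T / 2 / |(j : ℝ)| := by
    rw [hh, abs_div, abs_of_pos (by positivity : 0 < T / 2)]
    simp
  have h3 : ‖(2 : ℝ) • ∫ x in (0 : ℝ)..T, φ x‖ ≤ C * (T / 2 / |(j : ℝ)|) ^ γ * |T - 0| := by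
    rw [h2]
    refine intervalIntegral.norm_integral_le_of_norm_le_const fun x _ => ?_
    rw [norm_smul, fourier_apply, Circle.norm_coe, one_mul, ← habs]
    simpa using hC x (x + h)
  rw [norm_smul, sub_zero, abs_of_pos hT0] at h3
  norm_num at h3
  linarith
end

theorem Function.Periodic.continuous_lift {E : Type*} [TopologicalSpace E] {f : ℝ → E} {T : ℝ}
    (hper : Function.Periodic f T) (hf : Continuous f) :
    Continuous (hper.lift : AddCircle T → E) :=
  continuous_coinduced_dom.2 hf

theorem norm_fourierCoeff_lift_le {E : Type*} [NormedAddCommGroup E] [NormedSpace ℂ E]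
    [CompleteSpace E] {T : ℝ} [hT : Fact (0 < T)] {f : ℝ → E} (hper : Function.Periodic f T)
    {n : ℕ} (hf : ContDiff ℝ n f) {C γ : ℝ}
    (hC : ∀ x y, ‖iteratedDeriv n f x - iteratedDeriv n f y‖ ≤ C * |x - y| ^ γ)
    {j : ℤ} (hj : j ≠ 0) :
    ‖fourierCoeff (hper.lift : AddCircle T → E) j‖
      ≤ (T / (2 * Real.pi)) ^ n * (T / 2) ^ γ / 2 * C * (j.natAbs : ℝ) ^ (-(n + γ)) := by
  have hT0 := hT.out
  have hJ : (0 : ℝ) < |(j : ℝ)| := by positivity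
  have h := norm_intervalIntegral_fourier_smul_le (hper.iteratedDeriv_of_periodic n)
    (hf.continuous_iteratedDeriv n le_rfl) hC hj
  rw [intervalIntegral_fourier_smul_iteratedDeriv hper n hf, norm_smul] at h
  have hn : ‖(2 * Real.pi * Complex.I * j / T : ℂ) ^ n‖ = (2 * Real.pi / T) ^ n * |(j : ℝ)| ^ n := by
    simp only [norm_pow, norm_div, norm_mul, Complex.norm_I, Complex.norm_intCast,
      Complex.norm_real, Real.norm_eq_abs, abs_of_pos hT0, abs_of_pos Real.pi_pos]
    rw [← mul_pow]
    norm_num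
    ring
  rw [hn, Real.div_rpow (by positivity) hJ.le] at h
  rw [fourierCoeff_eq_intervalIntegral _ j 0, zero_add, norm_smul, Nat.cast_natAbs, Int.cast_abs,
    Real.rpow_neg hJ.le, Real.rpow_add hJ, Real.rpow_natCast]
  simp only [Function.Periodic.lift_coe]
  set I := ‖∫ x in (0 : ℝ)..T, fourier (-j) (x : AddCircle T) • f x‖
  rw [Real.norm_of_nonneg (by positivity)]
  have hpos : 0 < (2 * Real.pi / T) ^ n * |(j : ℝ)| ^ n := by positivity
  rw [mul_comm, ← le_div_iff₀ hpos] at h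
  calc 1 / T * I ≤ 1 / T * (T / 2 * (C * ((T / 2) ^ γ / |(j : ℝ)| ^ γ)) /
          ((2 * Real.pi / T) ^ n * |(j : ℝ)| ^ n)) := by gcongr
    _ = _ := by
      simp only [div_pow]
      field_simp

theorem hasSum_integral_norm_sq_sub_sum_fourier {E : Type*} [NormedAddCommGroup E]
    [InnerProductSpace ℂ E] [CompleteSpace E] [TopologicalSpace.SeparableSpace E]
    {T : ℝ} [hT : Fact (0 < T)] {F : AddCircle T → E} (hF : Continuous F) (S : Finset ℤ) :
    HasSum (fun k => if k ∈ S then 0 else ‖fourierCoeff F k‖ ^ 2)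
      (∫ x, ‖F x - ∑ j ∈ S, fourier j x • fourierCoeff F j‖ ^ 2 ∂haarAddCircle) := by
  have hG : Continuous fun x => F x - ∑ j ∈ S, fourier j x • fourierCoeff F j :=
    hF.sub (continuous_finsetSum _ fun j _ => (map_continuous _).smul continuous_const)
  convert! hasSum_norm_sq_fourierCoeff_of_continuous hG using 2 with k
  rw [fourierCoeff_sub_sum_fourier hF]
  split_ifs <;> simp

/-- `L²`-error of the Fourier truncation under algebraic decay of the coefficients. -/
theorem integral_norm_sq_sub_sum_fourier_le {E : Type*} [NormedAddCommGroup E]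
    [InnerProductSpace ℂ E] [CompleteSpace E] [TopologicalSpace.SeparableSpace E]
    {T : ℝ} [hT : Fact (0 < T)] {F : AddCircle T → E} (hF : Continuous F) {s K : ℝ} (hK : 0 < K) :
    ∃ D : ℝ, 0 < D ∧ ∀ A : ℝ, (∀ x, ‖F x‖ ≤ A) →
      (∀ j : ℤ, j ≠ 0 → ‖fourierCoeff F j‖ ≤ K * A * (j.natAbs : ℝ) ^ (-s)) →
      ∀ M : ℕ, 0 < M →
      ∫ x, ‖F x - ∑ j ∈ Finset.Icc (-(M : ℤ) + 1) M, fourier j x • fourierCoeff F j‖ ^ 2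
        ∂haarAddCircle ≤ D * (M : ℝ) ^ (1 - 2 * s) * A ^ 2 := by
  rcases le_or_gt s (1 / 2) with hs | hs
  · refine ⟨1, one_pos, fun A hA _ M hM => ?_⟩
    have hP := hasSum_norm_sq_fourierCoeff_of_continuous hF
    have hM1 : (1 : ℝ) ≤ (M : ℝ) ^ (1 - 2 * s) :=
      Real.one_le_rpow (by exact_mod_cast hM) (by linarith)
    calc _ ≤ ∫ x, ‖F x‖ ^ 2 ∂haarAddCircle := by
          refine hasSum_le (fun k => ?_) (hasSum_integral_norm_sq_sub_sum_fourier hF _) hP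
          split_ifs
          · positivity
          · rfl
      _ ≤ ∫ _ : AddCircle T, A ^ 2 ∂haarAddCircle := by
          refine integral_mono_of_nonneg (Filter.Eventually.of_forall fun _ => by positivity)
            (integrable_const _) (Filter.Eventually.of_forall fun x => ?_)
          exact pow_le_pow_left₀ (norm_nonneg _) (hA x) 2
      _ = A ^ 2 := by simp
      _ ≤ _ := by
          rw [one_mul]
          exact le_mul_of_one_le_left (sq_nonneg A) hM1
  · have hp : 0 < 2 * s - 1 := by linarith
    refine ⟨K ^ 2 * (2 * (1 + 1 / (2 * s - 1))), by positivity, fun A _ hA M hM => ?_⟩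
    obtain ⟨hS, hle⟩ := summable_and_tsum_int_tail_le (p := 2 * s) (by linarith) hM
    calc _ ≤ (K * A) ^ 2 * _ := by
          refine hasSum_le (fun k => ?_) (hasSum_integral_norm_sq_sub_sum_fourier hF _)
            (hS.hasSum.mul_left ((K * A) ^ 2))
          have hk := Finset.mem_Icc (a := -(M : ℤ) + 1) (b := M) (x := k)
          split_ifs with h1 h2 h2
          · positivity
          · simp
          · calc _ ≤ (K * A * (k.natAbs : ℝ) ^ (-s)) ^ 2 :=
                  pow_le_pow_left₀ (norm_nonneg _) (hA k (by omega)) 2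
              _ = _ := by
                  rw [mul_pow, ← Real.rpow_mul_natCast (by positivity)]
                  congr 2
                  push_cast
                  ring
          · have := mt hk.2 h1
            omega
      _ ≤ (K * A) ^ 2 * (2 * (1 + 1 / (2 * s - 1)) * (M : ℝ) ^ (1 - 2 * s)) := by gcongr
      _ = _ := by ring

end FourierTruncation

/-- Convergence rate of truncated Fourier sums of a `T`-periodic `C^{n,γ}` function with values
in a separable complex Hilbert space: the `L²`-error of the truncation to the modes
`−N/2+1, …, N/2` is `O(N^{−n−γ+1/2})` with constant independent of `N`. -/
theorem stmt_5 {E : Type*} [NormedAddCommGroup E] [InnerProductSpace ℂ E] [CompleteSpace E]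
    [TopologicalSpace.SeparableSpace E]
    (T : ℝ) (hT : 0 < T) (n : ℕ) (γ : ℝ) (hγ0 : 0 < γ) (hγ1 : γ < 1)
    (f : ℝ → E) (hper : Function.Periodic f T) (hf : ContDiff ℝ n f)
    (Cγ : ℝ)
    (hCγ : ∀ α₁ α₂ : ℝ, ‖iteratedDeriv n f α₁ - iteratedDeriv n f α₂‖ ≤ Cγ * |α₁ - α₂| ^ γ)
    (fhat : ℤ → E)
    (hfhat : ∀ j : ℤ, fhat j = (1 / (T : ℂ)) • ∫ α in (0:ℝ)..T,
        Complex.exp (-(((2 * Real.pi * (j : ℝ) * α / T : ℝ) : ℂ) * Complex.I)) • f α)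
    (fN : ℕ → ℝ → E)
    (hfN : ∀ (N : ℕ) (α : ℝ), fN N α = ∑ j ∈ Finset.Icc (-(N : ℤ) / 2 + 1) ((N : ℤ) / 2),
        Complex.exp (((2 * Real.pi * (j : ℝ) * α / T : ℝ) : ℂ) * Complex.I) • fhat j) :
    ∃ C : ℝ, 0 < C ∧ ∀ N : ℕ, 0 < N → Even N →
      Real.sqrt (∫ α in (0:ℝ)..T, ‖f α - fN N α‖ ^ 2)
        ≤ C * (N : ℝ) ^ (-(n : ℝ) - γ + 1 / 2) *
          (Cγ + ∑ m ∈ Finset.range (n + 1), ⨆ α : ℝ, ‖iteratedDeriv m f α‖) := by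
  have : Fact (0 < T) := ⟨hT⟩
  set F : AddCircle T → E := hper.lift
  have hF : Continuous F := hper.continuous_lift hf.continuous
  have hFf (x : ℝ) : F x = f x := hper.lift_coe x
  have hco (j : ℤ) : fhat j = fourierCoeff F j := by
    rw [hfhat, fourierCoeff_eq_intervalIntegral F j 0, zero_add, ← Complex.coe_smul (1 / T)]
    push_cast
    congr 1
    refine intervalIntegral.integral_congr fun x _ => ?_
    simp only [hFf, fourier_coe_apply]
    congr 2
    push_cast
    ring
  have hbdd : BddAbove (Set.range fun α => ‖f α‖) :=
    (hper.comp norm).compact_of_continuous hT.ne' hf.continuous.norm |>.bddAbove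
  set A := Cγ + ∑ m ∈ Finset.range (n + 1), ⨆ α : ℝ, ‖iteratedDeriv m f α‖
  have hCγ0 : 0 ≤ Cγ := by
    have := (norm_nonneg _).trans (hCγ 1 0)
    simpa using this
  have hsup (m : ℕ) : 0 ≤ ⨆ α : ℝ, ‖iteratedDeriv m f α‖ := Real.iSup_nonneg fun _ => norm_nonneg _
  have hCA : Cγ ≤ A := le_add_of_nonneg_right (Finset.sum_nonneg fun m _ => hsup m)
  have hFA (x : AddCircle T) : ‖F x‖ ≤ A := by
    induction x using QuotientAddGroup.induction_on with
    | H x =>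
      rw [hFf]
      calc ‖f x‖ ≤ ⨆ α, ‖f α‖ := le_ciSup hbdd x
        _ = ⨆ α, ‖iteratedDeriv 0 f α‖ := by simp
        _ ≤ ∑ m ∈ Finset.range (n + 1), ⨆ α : ℝ, ‖iteratedDeriv m f α‖ :=
          Finset.single_le_sum (f := fun m => ⨆ α : ℝ, ‖iteratedDeriv m f α‖)
            (fun m _ => hsup m) (by simp)
        _ ≤ A := le_add_of_nonneg_left hCγ0
  obtain ⟨D, hD, hmain⟩ := integral_norm_sq_sub_sum_fourier_le hF (s := n + γ)
    (K := (T / (2 * Real.pi)) ^ n * (T / 2) ^ γ / 2) (by positivity)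
  have hA0 : 0 ≤ A := hCγ0.trans hCA
  refine ⟨Real.sqrt (T * (D * 2⁻¹ ^ (1 - 2 * (n + γ)))), by positivity, fun N hN hNe => ?_⟩
  obtain ⟨M, rfl⟩ := hNe
  have hM : 0 < M := by omega
  have hle := hmain A hFA (fun j hj => (norm_fourierCoeff_lift_le hper hf hCγ hj).trans
    (by gcongr)) M hM
  rw [AddCircle.integral_haarAddCircle, ← AddCircle.intervalIntegral_preimage T 0, zero_add, smul_eq_mul,
    inv_mul_le_iff₀ hT] at hle
  have hint : ∫ α in (0 : ℝ)..T, ‖f α - fN (M + M) α‖ ^ 2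
      = ∫ a in (0 : ℝ)..T, ‖F a - ∑ j ∈ Finset.Icc (-(M : ℤ) + 1) M,
        fourier j (a : AddCircle T) • fourierCoeff F j‖ ^ 2 := by
    refine intervalIntegral.integral_congr fun x _ => ?_
    simp only [hFf, hfN, hco, fourier_coe_apply]
    rw [show -((M + M : ℕ) : ℤ) / 2 = -M by omega, show ((M + M : ℕ) : ℤ) / 2 = M by omega]
    congr 3
    refine Finset.sum_congr rfl fun j _ => ?_
    congr 2
    push_cast
    ring
  rw [hint]
  refine Real.sqrt_le_iff.2 ⟨by positivity, hle.trans (le_of_eq ?_)⟩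
  rw [mul_pow, mul_pow, Real.sq_sqrt (by positivity), ← Real.rpow_mul_natCast (by positivity),
    show (-(n : ℝ) - γ + 1 / 2) * (2 : ℕ) = 1 - 2 * (n + γ) by push_cast; ring,
    show (M : ℝ) = 2⁻¹ * ((M + M : ℕ) : ℝ) by push_cast; ring,
    Real.mul_rpow (by positivity) (by positivity)]
  ring
end

section
/- Let Λ > 0, Λ* := 2π/Λ, C_Λ := √(Λ/(2π)), and let φ : ℝ → ℂ be continuous with compact support. Define the Floquet–Bloch transform (Jφ)(α, x) := C_Λ Σ_{j ∈ ℤ} φ(x + Λj) e^{−iαΛj}. Then ∫_{−Λ*/2}^{Λ*/2} ∫_{−Λ/2}^{Λ/2} |(Jφ)(α, x)|² dx dα = ∫_ℝ |φ(x)|² dx, i.e. the Bloch transform is an isometry from L²(ℝ) onto L² of the product of the dual cell (−Λ*/2, Λ*/2] and the periodic cell (−Λ/2, Λ/2]. -/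
open MeasureTheory

/-- Orthogonality of the characters `α ↦ e^{iαΛn}` over one period of length `2π/Λ`. -/
theorem integral_exp_int_mul_period {Λ : ℝ} (hΛ : 0 < Λ) (n : ℤ) :
    (∫ α in (-(2 * Real.pi / Λ) / 2)..((2 * Real.pi / Λ) / 2),
        Complex.exp ((Λ * n * Complex.I) * (α : ℂ)))
      = if n = 0 then ((2 * Real.pi / Λ : ℝ) : ℂ) else 0 := by
  split_ifs with h
  · subst h
    simp
    ring
  · have hΛ' : (Λ : ℂ) ≠ 0 := by exact_mod_cast hΛ.ne'
    have hc : (Λ * n * Complex.I : ℂ) ≠ 0 := by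
      simp [hΛ', h]
    rw [integral_exp_mul_complex hc, div_eq_zero_iff]
    left
    rw [sub_eq_zero, Complex.exp_eq_exp_iff_exists_int]
    refine ⟨n, ?_⟩
    push_cast
    field_simp
    ring

/-- Parseval's identity for trigonometric polynomials of period `2π/Λ`. -/
theorem integral_norm_sq_sum_exp {Λ : ℝ} (hΛ : 0 < Λ) (s : Finset ℤ) (a : ℤ → ℂ) :
    (∫ α in (-(2 * Real.pi / Λ) / 2)..((2 * Real.pi / Λ) / 2),
        ‖∑ j ∈ s, a j * Complex.exp (-(((α * Λ * j : ℝ) : ℂ) * Complex.I))‖ ^ 2)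
      = 2 * Real.pi / Λ * ∑ j ∈ s, ‖a j‖ ^ 2 := by
  have key : ∀ α : ℝ,
      ((‖∑ j ∈ s, a j * Complex.exp (-(((α * Λ * j : ℝ) : ℂ) * Complex.I))‖ ^ 2 : ℝ) : ℂ)
      = ∑ j ∈ s, ∑ k ∈ s, a j * (starRingEnd ℂ) (a k) *
          Complex.exp ((Λ * (k - j : ℤ) * Complex.I) * (α : ℂ)) := by
    intro α
    push_cast
    rw [← Complex.mul_conj', map_sum, Finset.sum_mul_sum]
    refine Finset.sum_congr rfl fun j _ => Finset.sum_congr rfl fun k _ => ?_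
    rw [map_mul, ← Complex.exp_conj, mul_mul_mul_comm, ← Complex.exp_add]
    congr 2
    simp
    ring
  apply Complex.ofReal_injective
  rw [← intervalIntegral.integral_ofReal]
  simp_rw [key]
  rw [intervalIntegral.integral_finsetSum
    fun j _ => Continuous.intervalIntegrable (by fun_prop) _ _]
  rw [Complex.ofReal_mul, Complex.ofReal_sum, Finset.mul_sum]
  refine Finset.sum_congr rfl fun j hj => ?_
  rw [intervalIntegral.integral_finsetSum
    fun k _ => Continuous.intervalIntegrable (by fun_prop) _ _]
  simp_rw [intervalIntegral.integral_const_mul, integral_exp_int_mul_period hΛ, sub_eq_zero,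
    mul_ite, mul_zero]
  rw [Finset.sum_ite_eq' s j, if_pos hj, Complex.mul_conj']
  push_cast
  ring

/-- The integral over `ℝ` is the sum of the integrals over the translates of a centred cell. -/
theorem hasSum_integral_cell_translates {Λ : ℝ} (hΛ : 0 < Λ) {f : ℝ → ℝ} (hf : Integrable f) :
    HasSum (fun j : ℤ => ∫ x in (-(Λ / 2))..(Λ / 2), f (x + Λ * j)) (∫ x, f x) := by
  have h := ((hf.comp_mul_left' hΛ.ne').hasSum_intervalIntegral (-1 / 2)).mul_left Λ
  rw [Measure.integral_comp_mul_left f Λ, abs_of_pos (inv_pos.2 hΛ), smul_eq_mul,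
    mul_inv_cancel_left₀ hΛ.ne'] at h
  refine h.congr_fun ?_
  intro j
  rw [intervalIntegral.integral_comp_mul_left f hΛ.ne', smul_eq_mul,
    mul_inv_cancel_left₀ hΛ.ne', intervalIntegral.integral_comp_add_right f]
  congr 1 <;> ring

/-- Only finitely many translates of a compactly supported function meet the centred cell. -/
theorem HasCompactSupport.exists_finset_translate_eq_zero {φ : ℝ → ℂ} (hφ : HasCompactSupport φ)
    {Λ : ℝ} (hΛ : 0 < Λ) :
    ∃ s : Finset ℤ, ∀ x ∈ Set.Icc (-(Λ / 2)) (Λ / 2), ∀ j ∉ s, φ (x + Λ * j) = 0 := by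
  obtain ⟨R, hR⟩ := hφ.isCompact.isBounded.exists_norm_le
  obtain ⟨N, hN⟩ := exists_nat_gt ((R + Λ / 2) / Λ)
  rw [div_lt_iff₀ hΛ] at hN
  refine ⟨Finset.Icc (-N) N, fun x hx j hj => ?_⟩
  by_contra h
  have hb := abs_le.1 (hR _ (subset_tsupport φ h))
  refine hj (Finset.mem_Icc.2 ⟨?_, ?_⟩)
  · have : (-N : ℝ) < j := by nlinarith [hx.1, hx.2, hb.1, hb.2]
    exact_mod_cast this.le
  · have : (j : ℝ) < N := by nlinarith [hx.1, hx.2, hb.1, hb.2]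
    exact_mod_cast this.le

/-- The one-dimensional Floquet–Bloch transform
`(Jφ)(α, x) = √(Λ/(2π)) Σ_{j∈ℤ} φ(x + Λj) e^{−iαΛj}` of a continuous compactly supported
function is an isometry: the `L²` norm over the dual cell times the periodic cell equals the
`L²(ℝ)` norm of `φ`. -/
theorem stmt_8 (Λ : ℝ) (hΛ : 0 < Λ) (φ : ℝ → ℂ) (hφ : Continuous φ)
    (hsupp : HasCompactSupport φ)
    (J : ℝ → ℝ → ℂ)
    (hJ : ∀ α x : ℝ, J α x = (Real.sqrt (Λ / (2 * Real.pi)) : ℂ) *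
        ∑' j : ℤ, φ (x + Λ * j) * Complex.exp (-(((α * Λ * j : ℝ) : ℂ) * Complex.I))) :
    (∫ α in (-(2 * Real.pi / Λ) / 2)..((2 * Real.pi / Λ) / 2),
        ∫ x in (-(Λ / 2))..(Λ / 2), ‖J α x‖ ^ 2)
      = ∫ x : ℝ, ‖φ x‖ ^ 2 := by
  obtain ⟨s, hs⟩ := hsupp.exists_finset_translate_eq_zero hΛ
  have hcell : ∀ x ∈ Set.uIcc (-(Λ / 2)) (Λ / 2), x ∈ Set.Icc (-(Λ / 2)) (Λ / 2) := by
    intro x hx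
    rwa [Set.uIcc_of_le (by linarith)] at hx
  have hfin : ∀ α : ℝ, ∀ x ∈ Set.uIcc (-(Λ / 2)) (Λ / 2), ‖J α x‖ ^ 2 = Λ / (2 * Real.pi) *
      ‖∑ j ∈ s, φ (x + Λ * j) * Complex.exp (-(((α * Λ * j : ℝ) : ℂ) * Complex.I))‖ ^ 2 := by
    intro α x hx
    rw [hJ, tsum_eq_sum fun j hj => by rw [hs x (hcell x hx) j hj, zero_mul], norm_mul, mul_pow,
      Complex.norm_real, Real.norm_eq_abs, sq_abs, Real.sq_sqrt (by positivity)]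
  have hint : Integrable fun x => ‖φ x‖ ^ 2 :=
    Continuous.integrable_of_hasCompactSupport (by fun_prop)
      (hsupp.comp_left (g := fun z : ℂ => ‖z‖ ^ 2) (by simp))
  have hsum := hasSum_integral_cell_translates hΛ hint
  calc _ = ∫ α in (-(2 * Real.pi / Λ) / 2)..((2 * Real.pi / Λ) / 2),
        ∫ x in (-(Λ / 2))..(Λ / 2), Λ / (2 * Real.pi) *
      ‖∑ j ∈ s, φ (x + Λ * j) * Complex.exp (-(((α * Λ * j : ℝ) : ℂ) * Complex.I))‖ ^ 2 :=
        intervalIntegral.integral_congr fun α _ => intervalIntegral.integral_congr (hfin α)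
    _ = ∫ x in (-(Λ / 2))..(Λ / 2), ∫ α in (-(2 * Real.pi / Λ) / 2)..((2 * Real.pi / Λ) / 2),
          Λ / (2 * Real.pi) *
      ‖∑ j ∈ s, φ (x + Λ * j) * Complex.exp (-(((α * Λ * j : ℝ) : ℂ) * Complex.I))‖ ^ 2 := by
        apply intervalIntegral_intervalIntegral_swap
        refine (ContinuousOn.integrableOn_compact (isCompact_uIcc.prod isCompact_uIcc)
          (Continuous.continuousOn ?_)).mono_set
          (Set.prod_mono Set.uIoc_subset_uIcc Set.uIoc_subset_uIcc)
        fun_prop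
    _ = ∫ x in (-(Λ / 2))..(Λ / 2), ∑ j ∈ s, ‖φ (x + Λ * j)‖ ^ 2 := by
        refine intervalIntegral.integral_congr fun x _ => ?_
        rw [intervalIntegral.integral_const_mul,
          integral_norm_sq_sum_exp hΛ s fun j => φ (x + Λ * j)]
        field_simp
    _ = ∑ j ∈ s, ∫ x in (-(Λ / 2))..(Λ / 2), ‖φ (x + Λ * j)‖ ^ 2 :=
        intervalIntegral.integral_finsetSum
          fun j _ => Continuous.intervalIntegrable (by fun_prop) _ _
    _ = ∫ x : ℝ, ‖φ x‖ ^ 2 := by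
        refine (hasSum_sum_of_ne_finset_zero fun j hj => ?_).unique hsum
        rw [intervalIntegral.integral_congr (g := fun _ => (0 : ℝ))
          fun x hx => by simp [hs x (hcell x hx) j hj]]
        simp
end
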